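/- Let 0 < s < 1/2 and let f be a positive continuous function on [-1,1]. Denote Q₊ = {(y₁,y₂) : |y₁| < 1, 0 ≤ y₂ < f(y₁)}. Suppose K is a nonempty compact set properly contained in Q₊, in the sense that the reflected set K̃ = {(y₁, ±y₂) : (y₁,y₂) ∈ K} is contained in the interior of Q = {(y₁,y₂) : |y₁| < 1, |y₂| < f(y₁)}. Assume g ∈ H^s(Q₊) vanishes on Q₊ \ K. Then ∫_{x∈Q₊}∫_{y∈Q₊} |g(y)|²/(|x₁-y₁| + |x₂+y₂|)^{2+2s} dy dx ≤ C₁ ‖g‖²_{H^s(Q₊)}, where C₁ > 0 depends only on s, K, and f. -/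

import Mathlib

open MeasureTheory Set
open scoped ENNReal

noncomputable section

/-- The Euclidean plane ℝ². -/
abbrev E2 := EuclideanSpace ℝ (Fin 2)

/-- L² squared norm (extended-real valued) of a scalar function on `U ⊆ ℝ²`. -/
def l2sq (U : Set E2) (f : E2 → ℝ) : ℝ≥0∞ :=
  ∫⁻ x in U, ENNReal.ofReal ((f x) ^ 2)

/-- Squared Gagliardo seminorm of order `s` of a scalar function on `U ⊆ ℝ²`. -/
def gagsq (s : ℝ) (U : Set E2) (f : E2 → ℝ) : ℝ≥0∞ :=
  ∫⁻ x in U, ∫⁻ y in U,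
      ENNReal.ofReal ((f x - f y) ^ 2) / edist x y ^ (2 + 2 * s)

/-- The integral over the plane of a product of functions of one coordinate. -/
theorem lintegral_mul_coord {φ ψ : ℝ → ℝ≥0∞} (hφ : Measurable φ) (hψ : Measurable ψ) :
    ∫⁻ x : E2, φ (x 0) * ψ (x 1) = (∫⁻ t, φ t) * ∫⁻ t, ψ t := by
  have h := (volume_preserving_finTwoArrow ℝ).comp (PiLp.volume_preserving_ofLp (Fin 2))
  rw [← lintegral_prod_mul hφ.aemeasurable hψ.aemeasurable]
  rw [← Measure.volume_eq_prod, ← h.lintegral_comp (by fun_prop)]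
  rfl

theorem volume_coord_rect {S T : Set ℝ} (hS : MeasurableSet S) (hT : MeasurableSet T) :
    volume {z : E2 | z 0 ∈ S ∧ z 1 ∈ T} = volume S * volume T := by
  have h := lintegral_mul_coord (φ := S.indicator 1) (ψ := T.indicator 1)
    (measurable_one.indicator hS) (measurable_one.indicator hT)
  rw [lintegral_indicator_one hS, lintegral_indicator_one hT] at h
  rw [← h, ← lintegral_indicator_one]
  · congr 1 with z
    by_cases h0 : z 0 ∈ S <;> by_cases h1 : z 1 ∈ T <;> simp [indicator, h0, h1]
  · exact (hS.preimage (by fun_prop : Measurable fun z : E2 => z 0)).inter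
      (hT.preimage (by fun_prop : Measurable fun z : E2 => z 1))

theorem volume_coord_one_eq_zero : volume {z : E2 | z 1 = 0} = 0 := by
  have h := volume_coord_rect MeasurableSet.univ (measurableSet_singleton (0 : ℝ))
  simpa using h

theorem lintegral_abs_add_rpow_le {s c : ℝ} (hs : 0 < s) (hc : 0 < c) :
    ∫⁻ t : ℝ, ENNReal.ofReal ((|t| + c) ^ (-(1 + s))) ≤ ENNReal.ofReal (2 / s * c ^ (-s)) := by
  set h : ℝ → ℝ≥0∞ := (Ici c).indicator fun t => ENNReal.ofReal (t ^ (-(1 + s))) with hh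
  have hm : Measurable h := (by fun_prop : Measurable fun t : ℝ =>
    ENNReal.ofReal (t ^ (-(1 + s)))).indicator measurableSet_Ici
  have hint : ∫⁻ t, h t = ENNReal.ofReal (1 / s * c ^ (-s)) := by
    rw [hh, lintegral_indicator measurableSet_Ici, restrict_Ioi_eq_restrict_Ici.symm,
      ← ofReal_integral_eq_lintegral_ofReal, integral_Ioi_rpow_of_lt (by linarith) hc]
    · congr 1
      rw [show -(1 + s) + 1 = -s by ring]
      field_simp
    · exact integrableOn_Ioi_rpow_of_lt (by linarith) hc
    · filter_upwards [ae_restrict_mem measurableSet_Ioi] with t ht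
      exact Real.rpow_nonneg (hc.le.trans (le_of_lt ht)) _
  calc ∫⁻ t : ℝ, ENNReal.ofReal ((|t| + c) ^ (-(1 + s)))
      ≤ ∫⁻ t : ℝ, (h (t + c) + h (c - t)) := by
        refine lintegral_mono fun t => ?_
        rcases le_total 0 t with ht | ht
        · refine le_trans (le_of_eq ?_) le_self_add
          rw [hh, indicator_of_mem (by simpa using ht), abs_of_nonneg ht]
        · refine le_trans (le_of_eq ?_) le_add_self
          rw [hh, indicator_of_mem (by simpa using ht), abs_of_nonpos ht, neg_add_eq_sub]
    _ = ENNReal.ofReal (2 / s * c ^ (-s)) := by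
        rw [lintegral_add_left (by fun_prop), lintegral_add_right_eq_self h c,
          lintegral_sub_left_eq_self h c, hint, ← ENNReal.ofReal_add (by positivity) (by positivity)]
        congr 1
        ring

theorem edist_le_coord (x y : E2) :
    edist x y ≤ ENNReal.ofReal (|x 0 - y 0| + |x 1 - y 1|) := by
  rw [edist_dist, EuclideanSpace.dist_eq]
  apply ENNReal.ofReal_le_ofReal
  simp only [Fin.sum_univ_two, Real.dist_eq]
  apply Real.sqrt_le_iff.2 ⟨by positivity, ?_⟩
  nlinarith [abs_nonneg (x 0 - y 0), abs_nonneg (x 1 - y 1)]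

/-- A rectangle of size comparable to `y 1`, lying above `y` at relative height `lam`. -/
def upperBox (lam : ℝ) (y : E2) : Set E2 :=
  {z | |z 0 - y 0| < y 1 ∧ lam * y 1 < z 1 ∧ z 1 < 2 * lam * y 1}

open Classical in
/-- The averaging kernel on `upperBox lam y`, weighted by `y 1 ^ (-2s)`. -/
def boxKernel (s lam : ℝ) (y z : E2) : ℝ≥0∞ :=
  if z ∈ upperBox lam y then ENNReal.ofReal ((y 1) ^ (-(2 + 2 * s)) / (2 * lam)) else 0

theorem measurable_boxKernel (s lam : ℝ) :
    Measurable (Function.uncurry (boxKernel s lam)) := by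
  classical
  refine Measurable.ite ?_ (by fun_prop) measurable_const
  simp only [upperBox, ofPred_and]
  exact (measurableSet_lt (by fun_prop) (by fun_prop)).inter
    ((measurableSet_lt (by fun_prop) (by fun_prop)).inter
      (measurableSet_lt (by fun_prop) (by fun_prop)))

theorem measurableSet_upperBox (lam : ℝ) (y : E2) : MeasurableSet (upperBox lam y) := by
  simp only [upperBox, ofPred_and]
  exact (measurableSet_lt (by fun_prop) (by fun_prop)).inter
    ((measurableSet_lt (by fun_prop) (by fun_prop)).inter
      (measurableSet_lt (by fun_prop) (by fun_prop)))

theorem volume_upperBox {lam : ℝ} {y : E2} (hy : 0 < y 1) :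
    volume (upperBox lam y) = ENNReal.ofReal (2 * lam * y 1 ^ 2) := by
  have h := volume_coord_rect (measurableSet_Ioo (a := y 0 - y 1) (b := y 0 + y 1))
    (measurableSet_Ioo (a := lam * y 1) (b := 2 * lam * y 1))
  rw [Real.volume_Ioo, Real.volume_Ioo, ← ENNReal.ofReal_mul (by linarith)] at h
  convert h using 2
  · ext z
    simp only [upperBox, mem_ofPred_eq, mem_Ioo, abs_lt]
    constructor <;> rintro ⟨⟨h1, h2⟩, h3⟩ <;> exact ⟨⟨by linarith, by linarith⟩, h3⟩
  · ring

theorem lintegral_boxKernel_right {s lam : ℝ} (hlam : 0 < lam) {y : E2} (hy : 0 < y 1) :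
    ∫⁻ z in upperBox lam y, boxKernel s lam y z = ENNReal.ofReal ((y 1) ^ (-(2 * s))) := by
  rw [setLIntegral_congr_fun (g := fun _ => ENNReal.ofReal ((y 1) ^ (-(2 + 2 * s)) / (2 * lam)))
    (measurableSet_upperBox lam y) (fun z hz => by simp [boxKernel, hz]),
    setLIntegral_const, volume_upperBox hy, ← ENNReal.ofReal_mul (by positivity)]
  congr 1
  rw [show -(2 + 2 * s) = -(2 * s) - (2 : ℕ) by push_cast; ring, Real.rpow_sub_natCast hy.ne']
  field_simp

theorem lintegral_boxKernel_left_le {s lam : ℝ} (hs0 : 0 < s) (hs1 : s < 1 / 2) (hlam : 0 < lam)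
    {z : E2} (hz : 0 < z 1) :
    ∫⁻ y, boxKernel s lam y z
      ≤ ENNReal.ofReal (4 * lam ^ (2 * s - 1)) * ENNReal.ofReal ((z 1) ^ (-(2 * s))) := by
  set R : Set E2 := {y | y 0 ∈ Ioo (z 0 - z 1 / lam) (z 0 + z 1 / lam) ∧
    y 1 ∈ Ioo (z 1 / (2 * lam)) (z 1 / lam)} with hR
  have hRm : MeasurableSet R :=
    (measurableSet_Ioo.preimage (by fun_prop : Measurable fun z : E2 => z 0)).inter
      (measurableSet_Ioo.preimage (by fun_prop : Measurable fun z : E2 => z 1))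
  have hle : ∀ y, boxKernel s lam y z
      ≤ R.indicator (fun _ => ENNReal.ofReal ((z 1 / (2 * lam)) ^ (-(2 + 2 * s)) / (2 * lam))) y := by
    intro y
    by_cases hy : z ∈ upperBox lam y
    · obtain ⟨h0, h1, h2⟩ := hy
      have e1 : z 1 / (2 * lam) < y 1 := by rw [div_lt_iff₀ (by positivity)]; linarith
      have e2 : y 1 < z 1 / lam := by rw [lt_div_iff₀ (by positivity)]; linarith
      rw [abs_lt] at h0
      have hyR : y ∈ R := ⟨⟨by linarith, by linarith⟩, e1, e2⟩
      rw [indicator_of_mem hyR, boxKernel, if_pos ⟨abs_lt.2 h0, h1, h2⟩]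
      gcongr ENNReal.ofReal (?_ / _)
      exact Real.rpow_le_rpow_of_nonpos (by positivity) e1.le (by linarith)
    · simp [boxKernel, hy]
  refine (lintegral_mono hle).trans ?_
  rw [lintegral_indicator hRm, setLIntegral_const, hR, volume_coord_rect measurableSet_Ioo
    measurableSet_Ioo, Real.volume_Ioo, Real.volume_Ioo,
    ← ENNReal.ofReal_mul (by ring_nf; positivity), ← ENNReal.ofReal_mul (by positivity),
    ← ENNReal.ofReal_mul (by positivity)]
  apply ENNReal.ofReal_le_ofReal
  have k1 : (z 1 / (2 * lam)) ^ (-(2 + 2 * s))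
      = z 1 ^ (-(2 * s)) * (2 ^ (2 * s) * 4 * lam ^ (2 * s - 1) * lam ^ 3) / z 1 ^ 2 := by
    rw [Real.rpow_neg (by positivity), Real.div_rpow hz.le (by positivity),
      Real.mul_rpow (by norm_num) hlam.le, Real.rpow_neg hz.le,
      Real.rpow_sub hlam, Real.rpow_add hz, Real.rpow_add hlam, Real.rpow_add two_pos, Real.rpow_one]
    simp only [Real.rpow_two]
    field_simp
    norm_num
  have k2 : (2 : ℝ) ^ (2 * s) ≤ 2 := by
    calc (2 : ℝ) ^ (2 * s) ≤ 2 ^ (1 : ℝ) :=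
          Real.rpow_le_rpow_of_exponent_le (by norm_num) (by linarith)
      _ = 2 := Real.rpow_one 2
  have k3 : (z 1 / (2 * lam)) ^ (-(2 + 2 * s)) / (2 * lam) *
      ((z 0 + z 1 / lam - (z 0 - z 1 / lam)) * (z 1 / lam - z 1 / (2 * lam)))
      = 2 ^ (2 * s) * (2 * lam ^ (2 * s - 1) * z 1 ^ (-(2 * s))) := by
    rw [k1]
    field_simp
    ring
  rw [k3]
  have : 0 ≤ 2 * lam ^ (2 * s - 1) * z 1 ^ (-(2 * s)) := by positivity
  nlinarith

theorem ENNReal.le_two_mul_of_le_half_add {F R : ℝ≥0∞} (hF : F ≠ ⊤) (h : F ≤ 2⁻¹ * F + R) :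
    F ≤ 2 * R := by
  have h2 : 2⁻¹ * F ≠ ⊤ := ENNReal.mul_ne_top (by simp) hF
  have h3 : 2⁻¹ * F + 2⁻¹ * F ≤ 2⁻¹ * F + R := by
    rwa [← add_mul, ENNReal.inv_two_add_inv_two, one_mul]
  have h4 := (ENNReal.add_le_add_iff_left h2).1 h3
  calc F = 2 * (2⁻¹ * F) := by
        rw [← mul_assoc, ENNReal.mul_inv_cancel (by simp) (by simp), one_mul]
    _ ≤ 2 * R := by gcongr

theorem boxKernel_le_div_edist {s lam : ℝ} (hs0 : 0 < s) (hlam : 1 ≤ lam) {y : E2} (hy : 0 < y 1)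
    (z : E2) (D : ℝ≥0∞) :
    boxKernel s lam y z * D
      ≤ ENNReal.ofReal ((3 * lam) ^ (2 + 2 * s) / (2 * lam)) * (D / edist y z ^ (2 + 2 * s)) := by
  by_cases hz : z ∈ upperBox lam y
  swap
  · simp [boxKernel, hz]
  rw [boxKernel, if_pos hz]
  obtain ⟨h0, h1, h2⟩ := hz
  have hd : edist y z ≤ ENNReal.ofReal (3 * lam * y 1) := by
    refine (edist_le_coord y z).trans (ENNReal.ofReal_le_ofReal ?_)
    rw [abs_sub_comm] at h0
    have : |y 1 - z 1| ≤ 2 * lam * y 1 := by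
      rw [abs_le]; constructor <;> nlinarith
    nlinarith
  have hp : edist y z ^ (2 + 2 * s) ≤ ENNReal.ofReal ((3 * lam * y 1) ^ (2 + 2 * s)) := by
    rw [← ENNReal.ofReal_rpow_of_pos (by positivity)]
    exact ENNReal.rpow_le_rpow hd (by linarith)
  have hpos : 0 < (3 * lam * y 1) ^ (2 + 2 * s) := by positivity
  calc ENNReal.ofReal (y 1 ^ (-(2 + 2 * s)) / (2 * lam)) * D
      = ENNReal.ofReal ((3 * lam) ^ (2 + 2 * s) / (2 * lam))
          * (D / ENNReal.ofReal ((3 * lam * y 1) ^ (2 + 2 * s))) := by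
        rw [div_eq_mul_inv D, ← ENNReal.ofReal_inv_of_pos hpos, mul_comm D, ← mul_assoc,
          ← ENNReal.ofReal_mul (by positivity)]
        congr 2
        rw [Real.mul_rpow (by positivity) hy.le, Real.rpow_neg hy.le]
        field_simp
    _ ≤ _ := by gcongr

/-- Fractional Hardy inequality on `{a < y 1}`, with a constant uniform in `a`, for functions
supported at positive distance from the part of the boundary of `Q` off the line `y 1 = 0`. -/
theorem hardy_above {s r : ℝ} (hs0 : 0 < s) (hs1 : s < 1 / 2) (hr : 0 < r) {Q K : Set E2}
    (hQ : MeasurableSet Q)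
    (hKQ : ∀ y ∈ K, ∀ z : E2, |z 0 - y 0| < r → |z 1 - y 1| < r → 0 ≤ z 1 → z ∈ Q) :
    ∃ C : ℝ, 0 < C ∧ ∀ g : E2 → ℝ, Measurable g → (∀ x ∈ Q \ K, g x = 0) → ∀ a : ℝ, 0 < a →
      ∫⁻ y in Q ∩ {y | a < y 1}, ENNReal.ofReal (g y ^ 2) * ENNReal.ofReal (y 1 ^ (-(2 * s)))
        ≤ ENNReal.ofReal C * (l2sq Q g + gagsq s Q g) := by
  set lam : ℝ := 16 ^ (1 / (1 - 2 * s)) with hlamdef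
  have hlam : 1 ≤ lam := Real.one_le_rpow (by norm_num) (by
    apply div_nonneg <;> linarith)
  have hlam0 : 0 < lam := by linarith
  have hlams : lam ^ (2 * s - 1) = 1 / 16 := by
    rw [hlamdef, ← Real.rpow_mul (by norm_num),
      show 1 / (1 - 2 * s) * (2 * s - 1) = -1 by
        have : 1 - 2 * s ≠ 0 := by linarith
        field_simp
        ring]
    rw [Real.rpow_neg_one]; norm_num
  set ρ : ℝ := r / (3 * lam) with hρdef
  have hρ : 0 < ρ := by positivity
  set M : ℝ := (3 * lam) ^ (2 + 2 * s) / (2 * lam) with hM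
  have hM0 : 0 < M := by positivity
  have hρs : 0 < ρ ^ (-(2 * s)) := by positivity
  refine ⟨2 * (2 * M + ρ ^ (-(2 * s))), by positivity, fun g hg hgK a ha => ?_⟩
  by_cases hl2 : l2sq Q g = ⊤
  · rw [hl2, top_add, ENNReal.mul_top]
    · exact le_top
    · simp only [ne_eq, ENNReal.ofReal_eq_zero, not_le]; positivity
  set A : Set E2 := Q ∩ {y | a < y 1} with hA
  have hPm : MeasurableSet {y : E2 | a < y 1} := measurableSet_lt (by fun_prop) (by fun_prop)
  have hAm : MeasurableSet A := hQ.inter hPm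
  set G : E2 → ℝ≥0∞ := fun y => ENNReal.ofReal (g y ^ 2) with hG
  set w : E2 → ℝ≥0∞ := fun y => ENNReal.ofReal (y 1 ^ (-(2 * s))) with hw
  set D : E2 → E2 → ℝ≥0∞ := fun y z => ENNReal.ofReal ((g y - g z) ^ 2) with hD
  have hGm : Measurable G := by fun_prop
  have hwm : Measurable w := by fun_prop
  have hkm := measurable_boxKernel s lam
  have hk1 : ∀ y, Measurable (boxKernel s lam y) := fun y => hkm.of_uncurry_left
  have hk2 : ∀ z, Measurable fun y => boxKernel s lam y z := fun y => hkm.of_uncurry_right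
  have hfin : ∫⁻ y in A, G y * w y ≠ ⊤ := by
    have : ∫⁻ y in A, G y * w y ≤ ENNReal.ofReal (a ^ (-(2 * s))) * l2sq Q g := by
      calc ∫⁻ y in A, G y * w y ≤ ∫⁻ y in A, ENNReal.ofReal (a ^ (-(2 * s))) * G y := by
            refine setLIntegral_mono' hAm fun y hy => ?_
            rw [mul_comm]
            gcongr
            exact ENNReal.ofReal_le_ofReal
              (Real.rpow_le_rpow_of_nonpos ha (le_of_lt hy.2) (by linarith))
        _ = ENNReal.ofReal (a ^ (-(2 * s))) * ∫⁻ y in A, G y := lintegral_const_mul _ hGm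
        _ ≤ _ := by
            gcongr
            exact lintegral_mono_set inter_subset_left
    exact ne_top_of_le_ne_top (ENNReal.mul_ne_top (by simp) hl2) this
  have hpt : ∀ y ∈ A, G y * w y ≤ ENNReal.ofReal (ρ ^ (-(2 * s))) * G y +
      ((∫⁻ z in Q, boxKernel s lam y z * (2 * G z)) + ∫⁻ z in Q, boxKernel s lam y z * (2 * D y z)) := by
    intro y hy
    have hy0 : 0 < y 1 := ha.trans hy.2
    by_cases hyK : y ∈ K
    swap
    · have : g y = 0 := hgK y ⟨hy.1, hyK⟩
      simp [hG, this]
    rcases le_or_gt ρ (y 1) with hyρ | hyρ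
    · refine le_trans ?_ le_self_add
      rw [mul_comm]
      gcongr
      exact ENNReal.ofReal_le_ofReal (Real.rpow_le_rpow_of_nonpos hρ hyρ (by linarith))
    · refine le_trans ?_ le_add_self
      have hyr : 3 * lam * y 1 < r := by
        rw [hρdef, lt_div_iff₀ (by positivity)] at hyρ; linarith
      have hsub : upperBox lam y ⊆ Q := by
        rintro z ⟨h0, h1, h2⟩
        refine hKQ y hyK z (h0.trans (by nlinarith)) ?_ (by nlinarith)
        rw [abs_lt]; constructor <;> nlinarith
      rw [← lintegral_add_left (f := fun z => boxKernel s lam y z * (2 * G z))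
        ((hk1 y).mul (hGm.const_mul 2)),
        mul_comm, hw]
      simp only
      rw [← lintegral_boxKernel_right hlam0 hy0, ← lintegral_mul_const _ (hk1 y)]
      refine le_trans ?_ (lintegral_mono_set hsub)
      refine lintegral_mono fun z => ?_
      rw [← mul_add]
      gcongr
      simp only [hG, hD]
      rw [← mul_add, ← ENNReal.ofReal_add (by positivity) (by positivity),
        ← ENNReal.ofReal_ofNat 2, ← ENNReal.ofReal_mul (by norm_num)]
      apply ENNReal.ofReal_le_ofReal
      nlinarith [sq_nonneg (g z - (g y - g z))]
  have hT1 : ∫⁻ y in A, ∫⁻ z in Q, boxKernel s lam y z * (2 * G z)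
      ≤ 2⁻¹ * ∫⁻ z in A, G z * w z := by
    rw [lintegral_lintegral_swap (Measurable.aemeasurable (by
      refine hkm.mul ?_
      fun_prop)), ← lintegral_const_mul (f := fun z => G z * w z) _ (hGm.mul hwm), hA, inter_comm,
      ← setLIntegral_indicator hPm]
    refine setLIntegral_mono' hQ fun z hz => ?_
    by_cases hza : a < z 1
    · rw [indicator_of_mem (show z ∈ {y : E2 | a < y 1} from hza)]
      calc ∫⁻ y in {y : E2 | a < y 1} ∩ Q, boxKernel s lam y z * (2 * G z)
          ≤ ∫⁻ y, boxKernel s lam y z * (2 * G z) := setLIntegral_le_lintegral _ _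
        _ = (∫⁻ y, boxKernel s lam y z) * (2 * G z) := lintegral_mul_const _ (hk2 z)
        _ ≤ (ENNReal.ofReal (4 * lam ^ (2 * s - 1)) * w z) * (2 * G z) := by
            gcongr
            exact lintegral_boxKernel_left_le hs0 hs1 hlam0 (ha.trans hza)
        _ = (ENNReal.ofReal (4 * lam ^ (2 * s - 1)) * 2) * (G z * w z) := by ring
        _ = 2⁻¹ * (G z * w z) := by
            congr 1
            rw [hlams, ← ENNReal.ofReal_ofNat 2, ← ENNReal.ofReal_mul (by norm_num),
              ← ENNReal.ofReal_inv_of_pos (by norm_num)]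
            norm_num
    · rw [indicator_of_notMem (show z ∉ {y : E2 | a < y 1} from hza), nonpos_iff_eq_zero,
        setLIntegral_eq_zero_iff (hPm.inter hQ) ((hk2 z).mul_const _)]
      refine Filter.Eventually.of_forall fun y hy => ?_
      have hya : a < y 1 := hy.1
      have : z ∉ upperBox lam y := fun h => hza (by nlinarith [h.2.1])
      simp [boxKernel, this]
  have hT2 : ∫⁻ y in A, ∫⁻ z in Q, boxKernel s lam y z * (2 * D y z)
      ≤ ENNReal.ofReal (2 * M) * gagsq s Q g := by
    have hinner : ∀ y ∈ A, ∫⁻ z in Q, boxKernel s lam y z * (2 * D y z)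
        ≤ ENNReal.ofReal (2 * M) * ∫⁻ z in Q, D y z / edist y z ^ (2 + 2 * s) := by
      intro y hy
      rw [← lintegral_const_mul _ (by fun_prop)]
      refine lintegral_mono fun z => ?_
      rw [mul_left_comm, ENNReal.ofReal_mul (by norm_num), ENNReal.ofReal_ofNat, mul_assoc]
      refine mul_le_mul_right ?_ 2
      exact boxKernel_le_div_edist hs0 hlam (ha.trans hy.2) z _
    refine (setLIntegral_mono' hAm hinner).trans ?_
    rw [lintegral_const_mul' _ _ ENNReal.ofReal_ne_top]
    gcongr
    exact lintegral_mono_set inter_subset_left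
  have hF : ∫⁻ y in A, G y * w y ≤ 2⁻¹ * (∫⁻ y in A, G y * w y) +
      (ENNReal.ofReal (ρ ^ (-(2 * s))) * l2sq Q g + ENNReal.ofReal (2 * M) * gagsq s Q g) := by
    refine (setLIntegral_mono' hAm hpt).trans ?_
    rw [lintegral_add_left (hGm.const_mul _), lintegral_add_left, lintegral_const_mul _ hGm]
    · rw [add_left_comm]
      refine add_le_add hT1 (add_le_add ?_ hT2)
      gcongr
      exact lintegral_mono_set inter_subset_left
    · refine Measurable.lintegral_prod_right' (f := fun p : E2 × E2 =>
        boxKernel s lam p.1 p.2 * (2 * G p.2)) ?_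
      exact hkm.mul (by fun_prop)
  refine (ENNReal.le_two_mul_of_le_half_add hfin hF).trans ?_
  rw [ENNReal.ofReal_mul (p := 2) (q := 2 * M + ρ ^ (-(2 * s))) (by norm_num),
    ENNReal.ofReal_ofNat, mul_assoc, mul_add (ENNReal.ofReal (2 * M + ρ ^ (-(2 * s))))]
  refine mul_le_mul_right (add_le_add ?_ ?_) 2 <;> gcongr <;> linarith

/-- A bound uniform in `a > 0` for the Hardy integral over `{a < y 1}` passes to `{0 < y 1}`. -/
theorem hardy_half_plane {s : ℝ} {Q : Set E2} {g : E2 → ℝ} {B : ℝ≥0∞}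
    (h : ∀ a : ℝ, 0 < a → ∫⁻ y in Q ∩ {y | a < y 1},
      ENNReal.ofReal (g y ^ 2) * ENNReal.ofReal (y 1 ^ (-(2 * s))) ≤ B) :
    ∫⁻ y in Q ∩ {y | 0 < y 1},
      ENNReal.ofReal (g y ^ 2) * ENNReal.ofReal (y 1 ^ (-(2 * s))) ≤ B := by
  have hU : Q ∩ {y : E2 | 0 < y 1} = ⋃ n : ℕ, Q ∩ {y : E2 | 1 / ((n : ℝ) + 1) < y 1} := by
    rw [← inter_iUnion]
    congr 1
    ext y
    simp only [mem_ofPred_eq, mem_iUnion]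
    exact ⟨exists_nat_one_div_lt, fun ⟨n, hn⟩ => lt_trans (by positivity) hn⟩
  rw [hU, setLIntegral_iUnion_of_directed]
  · exact iSup_le fun n => h _ (by positivity)
  · refine Monotone.directed_le fun m n hmn => inter_subset_inter_right Q
      fun y (hy : 1 / ((m : ℝ) + 1) < y 1) => lt_of_le_of_lt (b := 1 / ((m : ℝ) + 1)) ?_ hy
    exact one_div_le_one_div_of_le (by positivity) (by gcongr)

theorem reflected_kernel_le {s : ℝ} (hs0 : 0 < s) {x y : E2} (hx : 0 ≤ x 1) (hy : 0 < y 1)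
    (G : ℝ≥0∞) :
    G / ENNReal.ofReal ((|x 0 - y 0| + |x 1 + y 1|) ^ (2 + 2 * s))
      ≤ G * (ENNReal.ofReal ((|x 0 - y 0| + y 1) ^ (-(1 + s)))
        * ENNReal.ofReal ((|x 1| + y 1) ^ (-(1 + s)))) := by
  rw [abs_of_pos (by linarith : 0 < x 1 + y 1), abs_of_nonneg hx]
  have h0 := abs_nonneg (x 0 - y 0)
  have hpos : 0 < |x 0 - y 0| + (x 1 + y 1) := by linarith
  rw [div_eq_mul_inv, ← ENNReal.ofReal_inv_of_pos (by positivity),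
    ← ENNReal.ofReal_mul (by positivity)]
  gcongr
  rw [← Real.rpow_neg hpos.le, show -(2 + 2 * s) = -(1 + s) + -(1 + s) by ring,
    Real.rpow_add hpos]
  gcongr ?_ * ?_
  · exact Real.rpow_le_rpow_of_nonpos (by linarith) (by linarith) (by linarith)
  · exact Real.rpow_le_rpow_of_nonpos (by linarith) (by linarith) (by linarith)

theorem lintegral_reflected_kernel_le {s : ℝ} (hs0 : 0 < s) {y : E2} (hy : 0 < y 1) :
    ∫⁻ x : E2, ENNReal.ofReal ((|x 0 - y 0| + y 1) ^ (-(1 + s)))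
        * ENNReal.ofReal ((|x 1| + y 1) ^ (-(1 + s)))
      ≤ ENNReal.ofReal (4 / s ^ 2) * ENNReal.ofReal (y 1 ^ (-(2 * s))) := by
  rw [lintegral_mul_coord (φ := fun t => ENNReal.ofReal ((|t - y 0| + y 1) ^ (-(1 + s))))
    (ψ := fun t => ENNReal.ofReal ((|t| + y 1) ^ (-(1 + s)))) (by fun_prop) (by fun_prop),
    lintegral_sub_right_eq_self (fun t => ENNReal.ofReal ((|t| + y 1) ^ (-(1 + s)))) (y 0)]
  refine (mul_le_mul' (lintegral_abs_add_rpow_le hs0 hy)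
    (lintegral_abs_add_rpow_le hs0 hy)).trans (le_of_eq ?_)
  rw [← ENNReal.ofReal_mul (by positivity), ← ENNReal.ofReal_mul (by positivity),
    show -(2 * s) = -s + -s by ring, Real.rpow_add hy]
  congr 1
  field_simp
  norm_num

theorem measurableSet_upper_subgraph {f : ℝ → ℝ} (hfc : ContinuousOn f (Icc (-1) 1)) :
    MeasurableSet {y : E2 | |y 0| < 1 ∧ 0 ≤ y 1 ∧ y 1 < f (y 0)} := by
  have hF : Continuous (IccExtend (by norm_num : (-1 : ℝ) ≤ 1) ((Icc (-1) 1).domRestrict f)) :=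
    hfc.domRestrict.Icc_extend'
  have heq : {y : E2 | |y 0| < 1 ∧ 0 ≤ y 1 ∧ y 1 < f (y 0)} = {y : E2 | |y 0| < 1 ∧ 0 ≤ y 1 ∧
      y 1 < IccExtend (by norm_num : (-1 : ℝ) ≤ 1) ((Icc (-1) 1).domRestrict f) (y 0)} := by
    ext y
    simp only [mem_ofPred_eq]
    refine and_congr_right fun h => and_congr_right fun _ => ?_
    rw [IccExtend_of_mem _ _ (abs_le.1 h.le)]
    rfl
  rw [heq, ofPred_and, ofPred_and]
  exact (measurableSet_lt (by fun_prop) (by fun_prop)).inter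
    ((measurableSet_le (by fun_prop) (by fun_prop)).inter
      (measurableSet_lt (by fun_prop) (by fun_prop)))

/-- Lemma 3.1: with Q₊ = {|y₁| < 1, 0 ≤ y₂ < f(y₁)} for a positive
continuous f on [-1,1], if K is a nonempty compact set properly contained in Q₊
(its reflection K̃ lies in the interior of Q = {|y₁| < 1, |y₂| < f(y₁)}) and
g ∈ H^s(Q₊) vanishes on Q₊ \ K, then
∫_{Q₊}∫_{Q₊} |g(y)|²/(|x₁-y₁|+|x₂+y₂|)^{2+2s} dy dx ≤ C₁ ‖g‖²_{H^s(Q₊)},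
with C₁ depending only on s, K, f. -/
theorem stmt_13 (s : ℝ) (hs0 : 0 < s) (hs1 : s < 1/2)
    (f : ℝ → ℝ) (hfc : ContinuousOn f (Icc (-1) 1)) (hfpos : ∀ t ∈ Icc (-1:ℝ) 1, 0 < f t)
    (K : Set E2) (hKne : K.Nonempty) (hKcomp : IsCompact K)
    (hKQ : K ⊆ {y : E2 | |y 0| < 1 ∧ 0 ≤ y 1 ∧ y 1 < f (y 0)})
    (hKint : {p : E2 | ∃ q ∈ K, p 0 = q 0 ∧ (p 1 = q 1 ∨ p 1 = -(q 1))}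
      ⊆ interior {y : E2 | |y 0| < 1 ∧ |y 1| < f (y 0)}) :
    ∃ C₁ : ℝ, 0 < C₁ ∧ ∀ g : E2 → ℝ, Measurable g →
      (∀ x ∈ {y : E2 | |y 0| < 1 ∧ 0 ≤ y 1 ∧ y 1 < f (y 0)} \ K, g x = 0) →
      (∫⁻ x in {y : E2 | |y 0| < 1 ∧ 0 ≤ y 1 ∧ y 1 < f (y 0)},
        ∫⁻ y in {y : E2 | |y 0| < 1 ∧ 0 ≤ y 1 ∧ y 1 < f (y 0)},
          ENNReal.ofReal ((g y) ^ 2) /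
            ENNReal.ofReal ((|x 0 - y 0| + |x 1 + y 1|) ^ (2 + 2 * s)))
      ≤ ENNReal.ofReal C₁ *
          (l2sq {y : E2 | |y 0| < 1 ∧ 0 ≤ y 1 ∧ y 1 < f (y 0)} g
            + gagsq s {y : E2 | |y 0| < 1 ∧ 0 ≤ y 1 ∧ y 1 < f (y 0)} g) := by
  set Q : Set E2 := {y : E2 | |y 0| < 1 ∧ 0 ≤ y 1 ∧ y 1 < f (y 0)} with hQdef
  have hQ : MeasurableSet Q := measurableSet_upper_subgraph hfc
  obtain ⟨δ, hδ, hthick⟩ := hKcomp.exists_thickening_subset_open isOpen_interior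
    (fun q hq => hKint ⟨q, hq, rfl, Or.inl rfl⟩)
  obtain ⟨C, hC, hardy⟩ := hardy_above (K := K) hs0 hs1 (half_pos hδ) hQ (by
    intro y hy z h0 h1 hz
    have hdist : dist z y < δ := by
      have := edist_le_coord z y
      rw [edist_dist, ENNReal.ofReal_le_ofReal_iff (by positivity)] at this
      linarith
    obtain ⟨hz0, hz1⟩ := interior_subset (hthick (Metric.mem_thickening_iff.2 ⟨y, hy, hdist⟩))
    exact ⟨hz0, hz, (le_abs_self _).trans_lt hz1⟩)
  refine ⟨4 / s ^ 2 * C, by positivity, fun g hg hgK => ?_⟩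
  have hP : (Q ∩ {y : E2 | 0 < y 1} : Set E2) =ᵐ[volume] Q := by
    filter_upwards [measure_eq_zero_iff_ae_notMem.1 volume_coord_one_eq_zero] with y hy
    refine propext ⟨fun h => h.1, fun h => ⟨h, lt_of_le_of_ne h.2.1 (Ne.symm hy)⟩⟩
  have hPm : MeasurableSet (Q ∩ {y : E2 | 0 < y 1}) :=
    hQ.inter (measurableSet_lt (by fun_prop) (by fun_prop))
  rw [lintegral_lintegral_swap (Measurable.aemeasurable (by
    simp only [Function.uncurry_def]; fun_prop)), ← setLIntegral_congr hP]
  calc _ ≤ ∫⁻ y in Q ∩ {y : E2 | 0 < y 1}, ENNReal.ofReal (4 / s ^ 2) *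
        (ENNReal.ofReal (g y ^ 2) * ENNReal.ofReal (y 1 ^ (-(2 * s)))) := by
        refine setLIntegral_mono' hPm fun y hy => ?_
        refine (setLIntegral_mono' hQ fun x hx =>
          reflected_kernel_le hs0 hx.2.1 hy.2 _).trans ?_
        rw [lintegral_const_mul _ (by fun_prop), mul_left_comm]
        gcongr
        exact (setLIntegral_le_lintegral _ _).trans (lintegral_reflected_kernel_le hs0 hy.2)
    _ = ENNReal.ofReal (4 / s ^ 2) * ∫⁻ y in Q ∩ {y : E2 | 0 < y 1},
        ENNReal.ofReal (g y ^ 2) * ENNReal.ofReal (y 1 ^ (-(2 * s))) :=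
        lintegral_const_mul _ (by fun_prop)
    _ ≤ ENNReal.ofReal (4 / s ^ 2) * (ENNReal.ofReal C * (l2sq Q g + gagsq s Q g)) := by
        gcongr
        exact hardy_half_plane fun a ha => hardy g hg hgK a ha
    _ = _ := by rw [← mul_assoc, ← ENNReal.ofReal_mul (by positivity)]

end
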